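/- Fix a pursuer position s_p ∈ V^N, a pursuer one-step strategy π_p ∈ Δ(Adj(s_p)), and for each s_p¹ ∈ Adj(s_p) a vector α[s_p¹] : V → ℝ; define α^σ : V → ℝ by α^σ(s) := 1 if s ∈ s_p, and α^σ(s) := γ·min_{s' ∈ adj(s)} Σ_{s_p¹ ∈ Adj(s_p)} π_p(s_p¹)·α[s_p¹](s') otherwise. Let v be a bounded value function such that for every s_p¹ ∈ Adj(s_p) and every b' ∈ Δ(V), v(s_p¹)(b') ≥ Σ_{s'∈V} α[s_p¹](s')·b'(s') (each α[s_p¹] is a valid lower linear bound on v(s_p¹), as holds when v(s_p¹) is the pointwise maximum of a finite set of α-vectors containing α[s_p¹]). Then for every b ∈ Δ(V): Σ_{s∈V} b(s)·α^σ(s) ≤ Q^v_{π_p}⟨s_p⟩(b). -/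

import Mathlib

open scoped Classical
open Finset

noncomputable section PEG

/-- The standard probability simplex over a finite set `V`. -/
def simplex (V : Type*) [Fintype V] : Set (V → ℝ) :=
  {b | (∀ v, 0 ≤ b v) ∧ ∑ v, b v = 1}

/-- Evader one-step strategies: for each vertex `s`, a probability distribution over `V`
supported on `adj s`. -/
def EStrat {V : Type*} [Fintype V] (adj : V → Finset V) : Set (V → V → ℝ) :=
  {π | ∀ s, (∀ s', 0 ≤ π s s') ∧ (∑ s', π s s' = 1) ∧ (∀ s', s' ∉ adj s → π s s' = 0)}

/-- Successor positions of the pursuer: move every unit along an edge. -/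
def AdjF {V : Type*} [Fintype V] {N : ℕ} (adj : V → Finset V) (s_p : Fin N → V) :
    Finset (Fin N → V) :=
  Finset.univ.filter (fun t => ∀ i, t i ∈ adj (s_p i))

/-- Pursuer one-step strategies at `s_p`: distributions over `Adj(s_p)`. -/
def PStrat {V : Type*} [Fintype V] {N : ℕ} (adj : V → Finset V) (s_p : Fin N → V) :
    Set ((Fin N → V) → ℝ) :=
  {π | (∀ t, 0 ≤ π t) ∧ ∑ t ∈ AdjF adj s_p, π t = 1}

/-- Probability mass on vertices occupied by the pursuer. -/
def capt {V : Type*} [Fintype V] {N : ℕ} (s_p : Fin N → V) (b : V → ℝ) : ℝ :=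
  ∑ s ∈ Finset.univ.filter (fun s => ∃ i, s_p i = s), b s

/-- Probability mass on vertices not occupied by the pursuer, `m(s_p, b)`. -/
def escMass {V : Type*} [Fintype V] {N : ℕ} (s_p : Fin N → V) (b : V → ℝ) : ℝ :=
  ∑ s ∈ Finset.univ.filter (fun s => ¬ ∃ i, s_p i = s), b s

/-- The updated belief `b_{π_e}` after the evader plays one-step strategy `π_e`. -/
def bUpd {V : Type*} [Fintype V] {N : ℕ} (s_p : Fin N → V) (b : V → ℝ)
    (π_e : V → V → ℝ) : V → ℝ :=
  fun s' => (1 / escMass s_p b) *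
    ∑ s ∈ Finset.univ.filter (fun s => ¬ ∃ i, s_p i = s), b s * π_e s s'

/-- `Q^v_{π_p}⟨s_p⟩(b)`: the value of playing the one-step strategy `π_p` in the first round
and continuing with value `v`. -/
def Qval {V : Type*} [Fintype V] {N : ℕ} (adj : V → Finset V) (γ : ℝ)
    (v : (Fin N → V) → (V → ℝ) → ℝ) (s_p : Fin N → V) (π_p : (Fin N → V) → ℝ)
    (b : V → ℝ) : ℝ :=
  if escMass s_p b = 0 then 1
  else capt s_p b + γ * escMass s_p b *
    sInf {x | ∃ π_e ∈ EStrat adj, x = ∑ t ∈ AdjF adj s_p, π_p t * v t (bUpd s_p b π_e)}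

/-- The dynamic-programming operator `H`. -/
def Hop {V : Type*} [Fintype V] {N : ℕ} (adj : V → Finset V) (γ : ℝ)
    (v : (Fin N → V) → (V → ℝ) → ℝ) : (Fin N → V) → (V → ℝ) → ℝ :=
  fun s_p b => sSup {x | ∃ π_p ∈ PStrat adj s_p, x = Qval adj γ v s_p π_p b}

/-- The sup-distance `‖v − v̄‖` between value functions (over beliefs in the simplex). -/
def supDist {V : Type*} [Fintype V] {N : ℕ} (v w : (Fin N → V) → (V → ℝ) → ℝ) : ℝ :=
  sSup {x | ∃ s_p : Fin N → V, ∃ b ∈ simplex V, x = |v s_p b - w s_p b|}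

/-- A value function is bounded. -/
def BoundedVF {V : Type*} [Fintype V] {N : ℕ} (v : (Fin N → V) → (V → ℝ) → ℝ) : Prop :=
  ∃ C : ℝ, ∀ s_p : Fin N → V, ∀ b ∈ simplex V, |v s_p b| ≤ C

/-- A value function is `[0,1]`-valued. -/
def UnitValued {V : Type*} [Fintype V] {N : ℕ} (v : (Fin N → V) → (V → ℝ) → ℝ) : Prop :=
  ∀ s_p : Fin N → V, ∀ b ∈ simplex V, 0 ≤ v s_p b ∧ v s_p b ≤ 1

end PEG

noncomputable section PEG2

/-- The `α`-vector `α^σ` of the composite strategy: play `π_p` in the first round, then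
continue with the strategy represented by `α t` after moving to `t`. -/
def alphaSigma {V : Type*} [Fintype V] {N : ℕ} (adj : V → Finset V)
    (hadj : ∀ s, (adj s).Nonempty) (γ : ℝ) (s_p : Fin N → V)
    (π_p : (Fin N → V) → ℝ) (α : (Fin N → V) → V → ℝ) : V → ℝ :=
  fun s => if ∃ i, s_p i = s then 1
    else γ * (adj s).inf' (hadj s) (fun s' => ∑ t ∈ AdjF adj s_p, π_p t * α t s')

end PEG2

/-- If every vertex has a neighbour, the evader has a one-step strategy. -/
lemma EStrat_nonempty {V : Type*} [Fintype V] (adj : V → Finset V)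
    (hadj : ∀ s, (adj s).Nonempty) : (EStrat adj).Nonempty := by
  refine ⟨fun s s' => if s' = (hadj s).choose then 1 else 0, fun s => ⟨fun s' => ?_, ?_, ?_⟩⟩
  · dsimp only
    split_ifs <;> norm_num
  · simp
  · intro s' hs'
    refine if_neg ?_
    rintro rfl
    exact hs' (hadj s).choose_spec

lemma capt_add_escMass {V : Type*} [Fintype V] {N : ℕ} (s_p : Fin N → V) (b : V → ℝ) :
    capt s_p b + escMass s_p b = ∑ s, b s :=
  Finset.sum_filter_add_sum_filter_not _ _ _

lemma escMass_nonneg {V : Type*} [Fintype V] {N : ℕ} (s_p : Fin N → V) {b : V → ℝ}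
    (hb : b ∈ simplex V) : 0 ≤ escMass s_p b :=
  Finset.sum_nonneg fun s _ => hb.1 s

/-- Integrating a function against the unnormalised updated belief. -/
lemma escMass_mul_sum_mul_bUpd {V : Type*} [Fintype V] {N : ℕ} (s_p : Fin N → V) (b : V → ℝ)
    (π_e : V → V → ℝ) (w : V → ℝ) (hm : escMass s_p b ≠ 0) :
    escMass s_p b * ∑ s', w s' * bUpd s_p b π_e s' =
      ∑ s ∈ Finset.univ.filter (fun s => ¬ ∃ i, s_p i = s), b s * ∑ s', π_e s s' * w s' := by
  have h : ∀ s', escMass s_p b * (w s' * bUpd s_p b π_e s') =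
      ∑ s ∈ Finset.univ.filter (fun s => ¬ ∃ i, s_p i = s), b s * (π_e s s' * w s') := by
    intro s'
    have h1 : escMass s_p b * bUpd s_p b π_e s' =
        ∑ s ∈ Finset.univ.filter (fun s => ¬ ∃ i, s_p i = s), b s * π_e s s' := by
      rw [bUpd, ← mul_assoc, mul_one_div_cancel hm, one_mul]
    rw [mul_left_comm, h1, Finset.mul_sum]
    exact Finset.sum_congr rfl fun s _ => by ring
  simp_rw [Finset.mul_sum, h]
  exact Finset.sum_comm

lemma bUpd_mem_simplex {V : Type*} [Fintype V] {N : ℕ} {adj : V → Finset V} (s_p : Fin N → V)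
    {b : V → ℝ} (hb : b ∈ simplex V) {π_e : V → V → ℝ} (hπ : π_e ∈ EStrat adj)
    (hm : escMass s_p b ≠ 0) : bUpd s_p b π_e ∈ simplex V := by
  constructor
  · intro s'
    exact mul_nonneg (one_div_nonneg.2 (escMass_nonneg s_p hb))
      (Finset.sum_nonneg fun s _ => mul_nonneg (hb.1 s) ((hπ s).1 s'))
  · have h := escMass_mul_sum_mul_bUpd s_p b π_e (fun _ => 1) hm
    simp only [one_mul, mul_one, (hπ _).2.1] at h
    exact mul_left_cancel₀ hm (h.trans (mul_one _).symm)

/-- The minimum of `w` over the neighbours of `s` is at most its mean under any evader move. -/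
lemma inf'_le_sum_EStrat {V : Type*} [Fintype V] {adj : V → Finset V}
    (hadj : ∀ s, (adj s).Nonempty) {π_e : V → V → ℝ} (hπ : π_e ∈ EStrat adj) (w : V → ℝ)
    (s : V) : (adj s).inf' (hadj s) w ≤ ∑ s', π_e s s' * w s' := by
  rw [← one_mul ((adj s).inf' (hadj s) w), ← (hπ s).2.1, Finset.sum_mul]
  refine Finset.sum_le_sum fun s' _ => ?_
  by_cases hs : s' ∈ adj s
  · exact mul_le_mul_of_nonneg_left (Finset.inf'_le _ hs) ((hπ s).1 s')
  · rw [(hπ s).2.2 s' hs, zero_mul, zero_mul]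

/-- The value of `α^σ` splits into the captured mass and the discounted continuation. -/
lemma sum_mul_alphaSigma {V : Type*} [Fintype V] {N : ℕ} (adj : V → Finset V)
    (hadj : ∀ s, (adj s).Nonempty) (γ : ℝ) (s_p : Fin N → V) (π_p : (Fin N → V) → ℝ)
    (α : (Fin N → V) → V → ℝ) (b : V → ℝ) :
    ∑ s, b s * alphaSigma adj hadj γ s_p π_p α s = capt s_p b +
      γ * ∑ s ∈ Finset.univ.filter (fun s => ¬ ∃ i, s_p i = s),
        b s * (adj s).inf' (hadj s) (fun s' => ∑ t ∈ AdjF adj s_p, π_p t * α t s') := by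
  rw [← Finset.sum_filter_add_sum_filter_not Finset.univ (fun s => ∃ i, s_p i = s), capt,
    Finset.mul_sum]
  congr 1
  · refine Finset.sum_congr rfl fun s hs => ?_
    rw [alphaSigma, if_pos (Finset.mem_filter.1 hs).2, mul_one]
  · refine Finset.sum_congr rfl fun s hs => ?_
    rw [alphaSigma, if_neg (Finset.mem_filter.1 hs).2, mul_left_comm]

/-- The lower bound `α^σ ≤ Q^v` at a belief, without a decidable-equality instance on `V` in scope,
so that all the filters involved use the same (classical) decidability instance. -/
lemma sum_mul_alphaSigma_le_Qval {V : Type*} [Fintype V] {N : ℕ} (adj : V → Finset V)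
    (hadj : ∀ s, (adj s).Nonempty) {γ : ℝ} (hγ0 : 0 ≤ γ) (s_p : Fin N → V)
    {π_p : (Fin N → V) → ℝ} (hπp : π_p ∈ PStrat adj s_p) (α : (Fin N → V) → V → ℝ)
    (v : (Fin N → V) → (V → ℝ) → ℝ)
    (hlow : ∀ t ∈ AdjF adj s_p, ∀ b' ∈ simplex V, ∑ s', α t s' * b' s' ≤ v t b')
    {b : V → ℝ} (hb : b ∈ simplex V) :
    ∑ s, b s * alphaSigma adj hadj γ s_p π_p α s ≤ Qval adj γ v s_p π_p b := by
  rw [sum_mul_alphaSigma, Qval]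
  split_ifs with hm
  · have hz : ∀ s ∈ Finset.univ.filter (fun s => ¬ ∃ i, s_p i = s), b s = 0 :=
      (Finset.sum_eq_zero_iff_of_nonneg fun s _ => hb.1 s).1 hm
    have hc := capt_add_escMass s_p b
    rw [hm, hb.2, add_zero] at hc
    rw [hc, Finset.sum_eq_zero fun s hs => by rw [hz s hs, zero_mul], mul_zero, add_zero]
  · have hpos : 0 < escMass s_p b := lt_of_le_of_ne (escMass_nonneg s_p hb) (Ne.symm hm)
    rw [mul_assoc]
    refine add_le_add_right (mul_le_mul_of_nonneg_left ?_ hγ0) _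
    rw [← div_le_iff₀' hpos]
    obtain ⟨π₀, hπ₀⟩ := EStrat_nonempty adj hadj
    refine le_csInf ⟨_, π₀, hπ₀, rfl⟩ ?_
    rintro x ⟨π_e, hπ, rfl⟩
    rw [div_le_iff₀' hpos]
    set w : V → ℝ := fun s' => ∑ t ∈ AdjF adj s_p, π_p t * α t s' with hw
    calc _ ≤ ∑ s ∈ Finset.univ.filter (fun s => ¬ ∃ i, s_p i = s),
          b s * ∑ s', π_e s s' * w s' :=
          Finset.sum_le_sum fun s _ =>
            mul_le_mul_of_nonneg_left (inf'_le_sum_EStrat hadj hπ w s) (hb.1 s)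
      _ = escMass s_p b * ∑ s', w s' * bUpd s_p b π_e s' :=
          (escMass_mul_sum_mul_bUpd s_p b π_e w hm).symm
      _ = escMass s_p b *
          ∑ t ∈ AdjF adj s_p, π_p t * ∑ s', α t s' * bUpd s_p b π_e s' := by
          simp_rw [hw, Finset.sum_mul, Finset.mul_sum, mul_assoc]
          rw [Finset.sum_comm]
      _ ≤ _ := mul_le_mul_of_nonneg_left
          (Finset.sum_le_sum fun t ht => mul_le_mul_of_nonneg_left
            (hlow t ht _ (bUpd_mem_simplex s_p hb hπ hm)) (hπp.1 t)) hpos.le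

/-- **Lemma 4 of the paper, lower-bound content.** If each continuation
`α`-vector `α[s_p¹]` is a valid lower linear bound on `v(s_p¹)` over the simplex, then the
linear function represented by the composite `α`-vector `α^σ` lower-bounds
`Q^v_{π_p}⟨s_p⟩` on the simplex. -/
theorem alphaSigma_le_Qval {V : Type*} [Fintype V] [DecidableEq V] [Nonempty V]
    (adj : V → Finset V) (hadj : ∀ s, (adj s).Nonempty)
    {N : ℕ} (hN : 0 < N) (γ : ℝ) (hγ0 : 0 ≤ γ) (hγ1 : γ < 1)
    (s_p : Fin N → V) (π_p : (Fin N → V) → ℝ) (hπp : π_p ∈ PStrat adj s_p)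
    (α : (Fin N → V) → V → ℝ)
    (v : (Fin N → V) → (V → ℝ) → ℝ) (hv : BoundedVF v)
    (hlow : ∀ t ∈ AdjF adj s_p, ∀ b' ∈ simplex V, ∑ s', α t s' * b' s' ≤ v t b') :
    ∀ b ∈ simplex V,
      ∑ s, b s * alphaSigma adj hadj γ s_p π_p α s ≤ Qval adj γ v s_p π_p b := by
  exact fun _ hb => sum_mul_alphaSigma_le_Qval adj hadj hγ0 s_p hπp α v hlow hb
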